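/- Let n be even and let M be a separately exchangeable random n×n matrix, i.e. M is equidistributed with the matrix (M_{σ(i)π(j)}) for any two non-random permutations σ, π of {1,…,n}. Write M in block form with four (n/2)×(n/2) blocks M^{(kℓ)}, 1 ≤ k, ℓ ≤ 2. Then all four blocks M^{(kℓ)} are equidistributed, and consequently P{‖M‖ ≥ t} ≤ 4·P{‖M^{(12)}‖ ≥ t/4} for every t ≥ 0. -/

import Mathlib

open MeasureTheory ProbabilityTheory Matrix Finset
open scoped ENNReal

/-- The spectral norm (ℓ₂ → ℓ₂ operator norm) of a real matrix. -/
noncomputable def specNorm {m n : ℕ} (A : Matrix (Fin m) (Fin n) ℝ) : ℝ :=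
  ‖LinearMap.toContinuousLinearMap (Matrix.toEuclideanLin A)‖

/-- The `(k,l)`-th block (`k, l ∈ {0,1}`, zero-based) of the decomposition of an `n × n`
matrix into four `(n/2) × (n/2)` blocks. -/
def blockOf {n : ℕ} (B : Matrix (Fin n) (Fin n) ℝ) (k l : Fin 2) :
    Matrix (Fin (n / 2)) (Fin (n / 2)) ℝ :=
  fun i j =>
    B ⟨k.1 * (n / 2) + i.1, by
        have h1 : k.1 * (n / 2) + i.1 < (k.1 + 1) * (n / 2) := by
          rw [Nat.add_mul, Nat.one_mul]; exact Nat.add_lt_add_left i.2 _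
        have h2 : (k.1 + 1) * (n / 2) ≤ 2 * (n / 2) := Nat.mul_le_mul_right _ k.2
        have h3 : 2 * (n / 2) ≤ n := by
          rw [Nat.mul_comm]; exact Nat.div_mul_le_self n 2
        exact lt_of_lt_of_le h1 (le_trans h2 h3)⟩
      ⟨l.1 * (n / 2) + j.1, by
        have h1 : l.1 * (n / 2) + j.1 < (l.1 + 1) * (n / 2) := by
          rw [Nat.add_mul, Nat.one_mul]; exact Nat.add_lt_add_left j.2 _
        have h2 : (l.1 + 1) * (n / 2) ≤ 2 * (n / 2) := Nat.mul_le_mul_right _ l.2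
        have h3 : 2 * (n / 2) ≤ n := by
          rw [Nat.mul_comm]; exact Nat.div_mul_le_self n 2
        exact lt_of_lt_of_le h1 (le_trans h2 h3)⟩

noncomputable instance matrixMeasurableSpace {m n : ℕ} :
    MeasurableSpace (Matrix (Fin m) (Fin n) ℝ) := MeasurableSpace.pi

open scoped Matrix.Norms.L2Operator

theorem specNorm_eq_norm {m n : ℕ} (A : Matrix (Fin m) (Fin n) ℝ) : specNorm A = ‖A‖ := by
  rw [Matrix.l2_opNorm_def]
  rfl

theorem measurable_specNorm {m n : ℕ} :
    Measurable (specNorm : Matrix (Fin m) (Fin n) ℝ → ℝ) := by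
  have : BorelSpace (Matrix (Fin m) (Fin n) ℝ) :=
    inferInstanceAs (BorelSpace (Fin m → Fin n → ℝ))
  have h : Continuous (Matrix.toEuclideanLin.trans LinearMap.toContinuousLinearMap :
      Matrix (Fin m) (Fin n) ℝ ≃ₗ[ℝ] _).toLinearMap :=
    LinearMap.continuous_of_finiteDimensional _
  exact h.norm.measurable

/-- The rows of the identity matrix selected by `f`. -/
def selectRows {m n : ℕ} (f : Fin m → Fin n) : Matrix (Fin m) (Fin n) ℝ :=
  (1 : Matrix (Fin n) (Fin n) ℝ).submatrix f id

theorem selectRows_apply {m n : ℕ} (f : Fin m → Fin n) (i : Fin m) (j : Fin n) :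
    selectRows f i j = (1 : Matrix (Fin n) (Fin n) ℝ) (f i) j := rfl

theorem selectRows_mul_mul_transpose {m n : ℕ} (f g : Fin m → Fin n)
    (A : Matrix (Fin n) (Fin n) ℝ) :
    selectRows f * A * (selectRows g)ᵀ = A.submatrix f g := by
  ext i j
  simp [selectRows_apply, Matrix.mul_apply, Matrix.one_apply]

theorem norm_selectRows_le {m n : ℕ} {f : Fin m → Fin n} (hf : Function.Injective f) :
    ‖selectRows f‖ ≤ 1 := by
  have h : (selectRows f)ᴴᴴ * (selectRows f)ᴴ = 1 := by
    have := selectRows_mul_mul_transpose f f 1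
    rw [Matrix.mul_one, Matrix.submatrix_one f hf] at this
    simpa using this
  have h1 : ‖(1 : Matrix (Fin m) (Fin m) ℝ)‖ ≤ 1 := by
    rw [← Matrix.l2_opNorm_toEuclideanCLM, map_one]
    exact ContinuousLinearMap.norm_id_le
  have h2 := Matrix.l2_opNorm_conjTranspose_mul_self (selectRows f)ᴴ
  rw [h, Matrix.l2_opNorm_conjTranspose] at h2
  nlinarith [norm_nonneg (selectRows f)]

theorem sum_transpose_selectRows_mul {m n p : ℕ} (e : Fin p × Fin m ≃ Fin n) :
    ∑ k, (selectRows fun i => e (k, i))ᵀ * selectRows (fun i => e (k, i)) = 1 := by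
  ext a b
  simp only [Matrix.sum_apply, Matrix.mul_apply, Matrix.transpose_apply, selectRows_apply]
  rw [← Fintype.sum_prod_type' (f := fun k i =>
      (1 : Matrix (Fin n) (Fin n) ℝ) (e (k, i)) a * (1 : Matrix (Fin n) (Fin n) ℝ) (e (k, i)) b),
    e.sum_comp (fun c =>
      (1 : Matrix (Fin n) (Fin n) ℝ) c a * (1 : Matrix (Fin n) (Fin n) ℝ) c b)]
  simp [Matrix.one_apply, eq_comm]

/-- The norm of a matrix is at most the sum of the norms of its blocks. -/
theorem norm_le_sum_norm_submatrix {m n p : ℕ} (e : Fin p × Fin m ≃ Fin n)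
    (A : Matrix (Fin n) (Fin n) ℝ) :
    ‖A‖ ≤ ∑ k, ∑ l, ‖A.submatrix (fun i => e (k, i)) (fun j => e (l, j))‖ := by
  let P (k : Fin p) := selectRows fun i => e (k, i)
  have hP (k : Fin p) : ‖P k‖ ≤ 1 :=
    norm_selectRows_le fun i j h => congrArg Prod.snd (e.injective h)
  have hPt (k : Fin p) : ‖(P k)ᵀ‖ ≤ 1 := by
    rw [← Matrix.conjTranspose_eq_transpose_of_trivial, Matrix.l2_opNorm_conjTranspose]
    exact hP k
  have hA : A = ∑ k, ∑ l, (P k)ᵀ * (P k * A * (P l)ᵀ) * P l := by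
    have h := sum_transpose_selectRows_mul e
    calc A = (∑ k, (P k)ᵀ * P k) * A * ∑ l, (P l)ᵀ * P l := by
          rw [h, Matrix.one_mul, Matrix.mul_one]
      _ = _ := by
          simp only [Matrix.sum_mul, Matrix.mul_sum, Matrix.mul_assoc]
          exact Finset.sum_comm
  conv_lhs => rw [hA]
  refine norm_sum_le_of_le _ fun k _ => norm_sum_le_of_le _ fun l _ => ?_
  rw [selectRows_mul_mul_transpose]
  set B := A.submatrix (fun i => e (k, i)) (fun j => e (l, j))
  calc ‖(P k)ᵀ * B * P l‖ ≤ ‖(P k)ᵀ‖ * ‖B‖ * ‖P l‖ :=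
        (Matrix.l2_opNorm_mul _ _).trans
          (mul_le_mul_of_nonneg_right (Matrix.l2_opNorm_mul _ _) (norm_nonneg _))
    _ ≤ 1 * ‖B‖ * 1 := by gcongr <;> simp [hP, hPt]
    _ = ‖B‖ := by ring

/-- The index of a block together with an index within the block determine a global index. -/
def halvesEquiv {n : ℕ} (hn : Even n) : Fin 2 × Fin (n / 2) ≃ Fin n :=
  finProdFinEquiv.trans (finCongr (Nat.two_mul_div_two_of_even hn))

theorem blockOf_eq_submatrix {n : ℕ} (hn : Even n) (B : Matrix (Fin n) (Fin n) ℝ)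
    (k l : Fin 2) :
    blockOf B k l =
      B.submatrix (fun i => halvesEquiv hn (k, i)) (fun j => halvesEquiv hn (l, j)) := by
  ext i j
  simp only [blockOf, Matrix.submatrix_apply]
  congr 1 <;> ext <;> simp [halvesEquiv, Nat.mul_comm, Nat.add_comm]

theorem specNorm_le_sum_blockOf {n : ℕ} (hn : Even n) (B : Matrix (Fin n) (Fin n) ℝ) :
    specNorm B ≤ ∑ k, ∑ l, specNorm (blockOf B k l) := by
  simpa only [specNorm_eq_norm, blockOf_eq_submatrix hn] using
    norm_le_sum_norm_submatrix (halvesEquiv hn) B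

theorem measurable_matrix_submatrix {m n p q : ℕ} (f : Fin p → Fin m) (g : Fin q → Fin n) :
    Measurable fun A : Matrix (Fin m) (Fin n) ℝ => A.submatrix f g :=
  measurable_pi_lambda _ fun i => measurable_pi_lambda _ fun j =>
    (measurable_pi_apply (g j)).comp (measurable_pi_apply (f i))

theorem measurable_blockOf {n : ℕ} (k l : Fin 2) :
    Measurable fun B : Matrix (Fin n) (Fin n) ℝ => blockOf B k l :=
  measurable_matrix_submatrix _ _

theorem exists_perm_blockOf_submatrix {n : ℕ} (hn : Even n) (k l k' l' : Fin 2) :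
    ∃ σ π : Equiv.Perm (Fin n), ∀ B : Matrix (Fin n) (Fin n) ℝ,
      blockOf (B.submatrix σ π) k' l' = blockOf B k l := by
  let τ (a b : Fin 2) : Equiv.Perm (Fin n) :=
    (halvesEquiv hn).permCongr ((Equiv.swap a b).prodCongr (Equiv.refl _))
  refine ⟨τ k k', τ l l', fun B => ?_⟩
  ext i j
  simp [blockOf_eq_submatrix hn, τ, Equiv.permCongr_apply]

/-- For a separately exchangeable random `n × n` matrix `M` (`n` even), the four
`(n/2) × (n/2)` blocks of `M` are all equidistributed, and consequently
`P{‖M‖ ≥ t} ≤ 4 P{‖M^{(12)}‖ ≥ t/4}` for all `t ≥ 0`. -/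
theorem stmt_8 (n : ℕ) (hn : Even n)
    (Ω : Type) [MeasurableSpace Ω] (μ : Measure Ω) [IsProbabilityMeasure μ]
    (M : Ω → Matrix (Fin n) (Fin n) ℝ)
    (hMmeas : Measurable M)
    -- M is separately exchangeable
    (hexch : ∀ σ π : Equiv.Perm (Fin n),
      Measure.map M μ = Measure.map (fun ω => (M ω).submatrix σ π) μ) :
    (∀ k l k' l' : Fin 2,
      Measure.map (fun ω => blockOf (M ω) k l) μ =
        Measure.map (fun ω => blockOf (M ω) k' l') μ) ∧
    ∀ t : ℝ, 0 ≤ t →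
      μ {ω | t ≤ specNorm (M ω)} ≤
        4 * μ {ω | t / 4 ≤ specNorm (blockOf (M ω) 0 1)} := by
  have hblock : ∀ k l k' l' : Fin 2,
      Measure.map (fun ω => blockOf (M ω) k l) μ =
        Measure.map (fun ω => blockOf (M ω) k' l') μ := by
    intro k l k' l'
    obtain ⟨σ, π, h⟩ := exists_perm_blockOf_submatrix hn k l k' l'
    have hmap := congrArg (Measure.map fun B => blockOf B k' l') (hexch σ π)
    rw [Measure.map_map (measurable_blockOf k' l') hMmeas,
      Measure.map_map (measurable_blockOf k' l')
        ((measurable_matrix_submatrix σ π).fun_comp hMmeas)] at hmap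
    simpa only [Function.comp_def, h] using hmap.symm
  refine ⟨hblock, fun t _ => ?_⟩
  have hprob (k l : Fin 2) :
      μ {ω | t / 4 ≤ specNorm (blockOf (M ω) k l)} =
        μ {ω | t / 4 ≤ specNorm (blockOf (M ω) 0 1)} := by
    have hS : MeasurableSet {A : Matrix (Fin (n / 2)) (Fin (n / 2)) ℝ | t / 4 ≤ specNorm A} :=
      measurableSet_le measurable_const measurable_specNorm
    have h := congrArg (fun ν => ν {A | t / 4 ≤ specNorm A}) (hblock k l 0 1)
    rwa [Measure.map_apply ((measurable_blockOf k l).fun_comp hMmeas) hS,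
      Measure.map_apply ((measurable_blockOf 0 1).fun_comp hMmeas) hS] at h
  calc μ {ω | t ≤ specNorm (M ω)}
      ≤ μ (⋃ k, ⋃ l, {ω | t / 4 ≤ specNorm (blockOf (M ω) k l)}) := by
        refine measure_mono fun ω hω => ?_
        by_contra hlt
        simp only [Set.mem_iUnion, Set.mem_ofPred_eq, not_exists, not_le] at hlt hω
        have hsum := specNorm_le_sum_blockOf hn (M ω)
        simp only [Fin.sum_univ_two] at hsum
        linarith [hlt 0 0, hlt 0 1, hlt 1 0, hlt 1 1]
    _ ≤ ∑ k, ∑ l, μ {ω | t / 4 ≤ specNorm (blockOf (M ω) k l)} :=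
        (measure_iUnion_fintype_le _ _).trans
          (Finset.sum_le_sum fun _ _ => measure_iUnion_fintype_le _ _)
    _ = 4 * μ {ω | t / 4 ≤ specNorm (blockOf (M ω) 0 1)} := by
        simp only [hprob, Finset.sum_const, Finset.card_univ, Fintype.card_fin, nsmul_eq_mul]
        rw [← mul_assoc]
        norm_num
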